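/- Corollary 1(c) (Maximum sum rate of PLNC): The supremum of x + y over all (x,y) in the PLNC rate region R_PLNC equals max{Σ_AB, Σ_BA, Σ_ABA + Σ_BAB}. -/

import Mathlib

/-- The time-sharing constraints of the protocol, with the time fractions eliminated. -/
lemma exists_time_fractions_iff {A B C D x y : ℝ} (hA : 0 < A) (hB : 0 < B) (hC : 0 < C)
    (hD : 0 < D) (hx : 0 ≤ x) (hy : 0 ≤ y) :
    (∃ l1 l2 l3 : ℝ, l1 ∈ Set.Icc (0 : ℝ) 1 ∧ l2 ∈ Set.Icc (0 : ℝ) 1 ∧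
      l3 ∈ Set.Icc (0 : ℝ) 1 ∧ l1 + l2 + l3 = 1 ∧
      x ≤ l1 * A ∧ x ≤ l3 * B ∧ y ≤ l2 * C ∧ y ≤ l3 * D) ↔
    x / A + y / C + max (x / B) (y / D) ≤ 1 := by
  simp only [← div_le_iff₀ hA, ← div_le_iff₀ hB, ← div_le_iff₀ hC, ← div_le_iff₀ hD]
  constructor
  · rintro ⟨l1, l2, l3, -, -, -, hsum, h1, h2, h3, h4⟩
    linarith [max_le h2 h4]
  · intro h
    have h1 : 0 ≤ x / A := by positivity
    have h2 : 0 ≤ y / C := by positivity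
    have h3 : 0 ≤ max (x / B) (y / D) := le_max_of_le_left (by positivity)
    refine ⟨x / A, 1 - x / A - max (x / B) (y / D), max (x / B) (y / D), ⟨h1, ?_⟩, ⟨?_, ?_⟩,
      ⟨h3, ?_⟩, ?_, le_rfl, le_max_left _ _, ?_, le_max_right _ _⟩ <;> linarith

/-- On the cone spanned by `(1, 0)` and `(d, b)`, a linear inequality follows from its validity
at the two generators. -/
lemma add_le_of_cone {a b c d x y M : ℝ} (hb : 0 < b) (hy : 0 ≤ y) (hyx : y * d ≤ x * b)
    (hM : 0 ≤ M) (hle : x * a + y * c + x * b ≤ 1) (h1 : 1 ≤ M * (a + b))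
    (h2 : d + b ≤ M * (d * a + b * c + d * b)) : x + y ≤ M := by
  have h3 : b * (x + y) ≤ b * (M * (x * a + y * c + x * b)) := by
    linarith [mul_le_mul_of_nonneg_left h1 (sub_nonneg.2 hyx), mul_le_mul_of_nonneg_left h2 hy]
  have h4 := le_of_mul_le_mul_left h3 hb
  linarith [mul_le_mul_of_nonneg_left hle hM]


/-- Corollary 1(c): the maximum sum rate of PLNC is `max {Σ_AB, Σ_BA, Σ_ABA + Σ_BAB}`. -/
theorem plnc_max_sum_rate (C_AD C_DB C_BD C_DA : ℝ)
    (hAD : 0 < C_AD) (hDB : 0 < C_DB) (hBD : 0 < C_BD) (hDA : 0 < C_DA) :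
    let S_AB : ℝ := (1 / C_AD + 1 / C_DB)⁻¹
    let S_BA : ℝ := (1 / C_BD + 1 / C_DA)⁻¹
    let S_ABA : ℝ := (1 / C_AD + 1 / C_DB + C_DA / (C_BD * C_DB))⁻¹
    let S_BAB : ℝ := (1 / C_BD + 1 / C_DA + C_DB / (C_AD * C_DA))⁻¹
    let R_PLNC : Set (ℝ × ℝ) := {p | 0 ≤ p.1 ∧ 0 ≤ p.2 ∧
      ∃ l1 l2 l3 : ℝ, l1 ∈ Set.Icc (0 : ℝ) 1 ∧ l2 ∈ Set.Icc (0 : ℝ) 1 ∧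
        l3 ∈ Set.Icc (0 : ℝ) 1 ∧ l1 + l2 + l3 = 1 ∧
        p.1 ≤ l1 * C_AD ∧ p.1 ≤ l3 * C_DB ∧ p.2 ≤ l2 * C_BD ∧ p.2 ≤ l3 * C_DA}
    sSup ((fun p : ℝ × ℝ => p.1 + p.2) '' R_PLNC) = max (max S_AB S_BA) (S_ABA + S_BAB) := by
  intro S_AB S_BA S_ABA S_BAB R_PLNC
  have mem_R (p : ℝ × ℝ) : p ∈ R_PLNC ↔ 0 ≤ p.1 ∧ 0 ≤ p.2 ∧
      p.1 / C_AD + p.2 / C_BD + max (p.1 / C_DB) (p.2 / C_DA) ≤ 1 :=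
    and_congr_right fun hx => and_congr_right fun hy =>
      exists_time_fractions_iff hAD hDB hBD hDA hx hy
  have hS_AB : 0 < S_AB := by positivity
  have hS_BA : 0 < S_BA := by positivity
  have hS_ABA : 0 < S_ABA := by positivity
  have hS_BAB : 0 < S_BAB := by positivity
  have mul_AB : S_AB * (C_AD⁻¹ + C_DB⁻¹) = 1 := by
    simp only [S_AB]; field_simp
  have mul_BA : S_BA * (C_BD⁻¹ + C_DA⁻¹) = 1 := by
    simp only [S_BA]; field_simp
  have mul_ABA : S_ABA * (C_DA⁻¹ * C_AD⁻¹ + C_DB⁻¹ * C_BD⁻¹ + C_DA⁻¹ * C_DB⁻¹) = C_DA⁻¹ := by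
    simp only [S_ABA]; field_simp; ring
  have mul_BAB : S_BAB * (C_DA⁻¹ * C_AD⁻¹ + C_DB⁻¹ * C_BD⁻¹ + C_DA⁻¹ * C_DB⁻¹) = C_DB⁻¹ := by
    simp only [S_BAB]; field_simp; ring
  have mem_AB : (S_AB, (0 : ℝ)) ∈ R_PLNC := by
    refine (mem_R _).2 ⟨hS_AB.le, le_rfl, ?_⟩
    have : 0 ≤ S_AB / C_DB := by positivity
    simp only [zero_div, max_eq_left this]
    simp only [div_eq_mul_inv]
    linarith
  have mem_BA : ((0 : ℝ), S_BA) ∈ R_PLNC := by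
    refine (mem_R _).2 ⟨le_rfl, hS_BA.le, ?_⟩
    have : 0 ≤ S_BA / C_DA := by positivity
    simp only [zero_div, max_eq_right this]
    simp only [div_eq_mul_inv]
    linarith
  have mem_both : (S_ABA, S_BAB) ∈ R_PLNC := by
    refine (mem_R _).2 ⟨hS_ABA.le, hS_BAB.le, ?_⟩
    have h : S_ABA / C_DB = S_BAB / C_DA := by
      simp only [S_ABA, S_BAB]; field_simp; ring
    simp only [h, max_self]
    apply le_of_eq
    simp only [S_ABA, S_BAB]
    field_simp
    ring
  refine IsGreatest.csSup_eq ⟨?_, ?_⟩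
  · rcases max_choice (max S_AB S_BA) (S_ABA + S_BAB) with h | h
    · rcases max_choice S_AB S_BA with h' | h'
      · exact ⟨_, mem_AB, (add_zero _).trans (h.trans h').symm⟩
      · exact ⟨_, mem_BA, (zero_add _).trans (h.trans h').symm⟩
    · exact ⟨_, mem_both, h.symm⟩
  · rintro _ ⟨⟨x, y⟩, hp, rfl⟩
    obtain ⟨hx, hy, h⟩ := (mem_R _).1 hp
    simp only [div_eq_mul_inv] at hx hy h ⊢
    set M := max (max S_AB S_BA) (S_ABA + S_BAB)
    have hM_AB : S_AB ≤ M := (le_max_left _ _).trans (le_max_left _ _)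
    have hM_BA : S_BA ≤ M := (le_max_right _ _).trans (le_max_left _ _)
    have hM_both : S_ABA + S_BAB ≤ M := le_max_right _ _
    have hM : 0 ≤ M := hS_AB.le.trans hM_AB
    have h_AB : 1 ≤ M * (C_AD⁻¹ + C_DB⁻¹) := mul_AB ▸ by gcongr
    have h_BA : 1 ≤ M * (C_BD⁻¹ + C_DA⁻¹) := mul_BA ▸ by gcongr
    have h_both : C_DA⁻¹ + C_DB⁻¹ ≤
        M * (C_DA⁻¹ * C_AD⁻¹ + C_DB⁻¹ * C_BD⁻¹ + C_DA⁻¹ * C_DB⁻¹) := by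
      calc C_DA⁻¹ + C_DB⁻¹ = (S_ABA + S_BAB) * _ := by rw [add_mul, mul_ABA, mul_BAB]
        _ ≤ _ := by gcongr
    rcases le_total (y * C_DA⁻¹) (x * C_DB⁻¹) with hyx | hxy
    · exact add_le_of_cone (inv_pos.2 hDB) hy hyx hM (by rwa [max_eq_left hyx] at h) h_AB h_both
    · rw [max_eq_right hxy] at h
      rw [add_comm x y]
      exact add_le_of_cone (c := C_AD⁻¹) (inv_pos.2 hDA) hx hxy hM (by linarith) h_BA (by linarith)
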